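/- arXiv:2309.10405 — 2 statements merged into one kernel-verified Lean document; each statement's English description precedes it below -/
import Mathlib

section
/- Fix H > 0, 0 < B < 1, and a, b > 0 with a² ≤ b². Let x(s) = (1/H)·√(1 + B² + 2B·sin(Hs + 3π/2)), z(s) = ∫_{3π/(2H)}^{s + 3π/(2H)} (1 + B·sin(Ht))/√(1 + B² + 2B·sin(Ht)) dt, s₀ = (1/H)·arcsin(−B) + π/(2H), and ρ(s) = x(s) − (x'(s)/z'(s))·z(s)·(b²/a²) on [−s₀, s₀]. Then ρ is strictly increasing on (−s₀, 0) and strictly decreasing on (0, s₀); in particular ρ'(s) > 0 for s ∈ (−s₀, 0) and ρ'(s) < 0 for s ∈ (0, s₀). -/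
open Real

/-- Kenmotsu's profile function `x(s) = (1/H)√(1 + B² + 2B sin(Hs + 3π/2))`. -/
noncomputable def kenX (H B : ℝ) (s : ℝ) : ℝ :=
  (1 / H) * Real.sqrt (1 + B ^ 2 + 2 * B * Real.sin (H * s + 3 * Real.pi / 2))

/-- Kenmotsu's height function
`z(s) = ∫_{3π/(2H)}^{s + 3π/(2H)} (1 + B sin(Ht))/√(1 + B² + 2B sin(Ht)) dt`. -/
noncomputable def kenZ (H B : ℝ) (s : ℝ) : ℝ :=
  ∫ t in (3 * Real.pi / (2 * H))..(s + 3 * Real.pi / (2 * H)),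
    (1 + B * Real.sin (H * t)) / Real.sqrt (1 + B ^ 2 + 2 * B * Real.sin (H * t))

/-- The function `ρ` of the Kenmotsu unduloid. -/
noncomputable def kenRho (H B a b : ℝ) (s : ℝ) : ℝ :=
  kenX H B s - (deriv (kenX H B) s / deriv (kenZ H B) s) * kenZ H B s *
    (b ^ 2 / a ^ 2)

theorem sin_add_three_pi_div_two (y : ℝ) : sin (y + 3 * π / 2) = -cos y := by
  rw [show y + 3 * π / 2 = y + π / 2 + π by ring, sin_add_pi, sin_add_pi_div_two]

theorem one_add_sq_add_two_mul_pos {B u : ℝ} (hB0 : 0 < B) (hB1 : B < 1) (hu : -1 ≤ u) :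
    0 < 1 + B ^ 2 + 2 * B * u := by
  nlinarith [mul_le_mul_of_nonneg_left hu hB0.le, sq_pos_of_pos (sub_pos.2 hB1)]

theorem one_sub_mul_cos_pos {B : ℝ} (hB0 : 0 < B) (hB1 : B < 1) (y : ℝ) :
    0 < 1 - B * cos y := by
  nlinarith [cos_le_one y]

theorem hasDerivAt_kenX {H B : ℝ} (hH : 0 < H) (hB0 : 0 < B) (hB1 : B < 1) (s : ℝ) :
    HasDerivAt (kenX H B) (B * sin (H * s) / √(1 + B ^ 2 + 2 * B * -cos (H * s))) s := by
  have hD : 0 < 1 + B ^ 2 + 2 * B * -cos (H * s) :=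
    one_add_sq_add_two_mul_pos hB0 hB1 (neg_le_neg (cos_le_one _))
  have hfun : kenX H B = fun s => (1 / H) * √(1 + B ^ 2 + 2 * B * -cos (H * s)) := by
    funext s
    rw [kenX, sin_add_three_pi_div_two]
  rw [hfun]
  have hlin : HasDerivAt (fun s : ℝ => H * s) H s := by
    simpa using (hasDerivAt_id s).const_mul H
  have h := (((hlin.cos.neg.const_mul (2 * B)).const_add (1 + B ^ 2)).sqrt
    hD.ne').const_mul (1 / H)
  refine h.congr_deriv ?_
  have := (sqrt_pos.2 hD).ne'
  simp only [Pi.neg_apply]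
  field_simp

theorem hasDerivAt_kenZ {H B : ℝ} (hH : 0 < H) (hB0 : 0 < B) (hB1 : B < 1) (s : ℝ) :
    HasDerivAt (kenZ H B)
      ((1 - B * cos (H * s)) / √(1 + B ^ 2 + 2 * B * -cos (H * s))) s := by
  have hcont : Continuous fun t : ℝ =>
      (1 + B * sin (H * t)) / √(1 + B ^ 2 + 2 * B * sin (H * t)) := by
    refine Continuous.div (by fun_prop) (by fun_prop) fun t => ?_
    exact (sqrt_pos.2 (one_add_sq_add_two_mul_pos hB0 hB1 (neg_one_le_sin _))).ne'
  have h := (hcont.integral_hasStrictDerivAt (3 * π / (2 * H))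
    (s + 3 * π / (2 * H))).hasDerivAt.comp_add_const s (3 * π / (2 * H))
  refine HasDerivAt.congr_deriv h ?_
  rw [show H * (s + 3 * π / (2 * H)) = H * s + 3 * π / 2 by field_simp,
    sin_add_three_pi_div_two]
  ring_nf

theorem strictMono_kenZ {H B : ℝ} (hH : 0 < H) (hB0 : 0 < B) (hB1 : B < 1) :
    StrictMono (kenZ H B) := by
  refine strictMono_of_deriv_pos fun s => ?_
  rw [(hasDerivAt_kenZ hH hB0 hB1 s).deriv]
  exact div_pos (one_sub_mul_cos_pos hB0 hB1 _)
    (sqrt_pos.2 (one_add_sq_add_two_mul_pos hB0 hB1 (neg_le_neg (cos_le_one _))))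

theorem kenZ_zero (H B : ℝ) : kenZ H B 0 = 0 := by
  simp [kenZ]

theorem deriv_kenX_div_deriv_kenZ {H B : ℝ} (hH : 0 < H) (hB0 : 0 < B) (hB1 : B < 1) (s : ℝ) :
    deriv (kenX H B) s / deriv (kenZ H B) s = B * sin (H * s) / (1 - B * cos (H * s)) := by
  have hD : 0 < 1 + B ^ 2 + 2 * B * -cos (H * s) :=
    one_add_sq_add_two_mul_pos hB0 hB1 (neg_le_neg (cos_le_one _))
  rw [(hasDerivAt_kenX hH hB0 hB1 s).deriv, (hasDerivAt_kenZ hH hB0 hB1 s).deriv,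
    div_div_div_cancel_right₀ (sqrt_pos.2 hD).ne']

theorem hasDerivAt_kenRho {H B : ℝ} (a b : ℝ) (hH : 0 < H) (hB0 : 0 < B) (hB1 : B < 1) (s : ℝ) :
    HasDerivAt (kenRho H B a b)
      ((1 - b ^ 2 / a ^ 2) * (B * sin (H * s) / √(1 + B ^ 2 + 2 * B * -cos (H * s))) -
        b ^ 2 / a ^ 2 * (B * H * (cos (H * s) - B) / (1 - B * cos (H * s)) ^ 2 *
          kenZ H B s)) s := by
  have hc := (one_sub_mul_cos_pos hB0 hB1 (H * s)).ne'
  have hfun : kenRho H B a b = fun s => kenX H B s -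
      B * sin (H * s) / (1 - B * cos (H * s)) * kenZ H B s * (b ^ 2 / a ^ 2) := by
    funext s
    rw [kenRho, deriv_kenX_div_deriv_kenZ hH hB0 hB1]
  rw [hfun]
  have hlin : HasDerivAt (fun s : ℝ => H * s) H s := by
    simpa using (hasDerivAt_id s).const_mul H
  have hslope : HasDerivAt (fun s => B * sin (H * s) / (1 - B * cos (H * s)))
      (B * H * (cos (H * s) - B) / (1 - B * cos (H * s)) ^ 2) s := by
    refine ((hlin.sin.const_mul B).div ((hlin.cos.const_mul B).const_sub 1) hc).congr_deriv ?_
    congr 1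
    linear_combination (-B ^ 2 * H) * sin_sq_add_cos_sq (H * s)
  refine ((hasDerivAt_kenX hH hB0 hB1 s).sub
    ((hslope.mul (hasDerivAt_kenZ hH hB0 hB1 s)).mul_const (b ^ 2 / a ^ 2))).congr_deriv ?_
  have hcancel : B * sin (H * s) / (1 - B * cos (H * s)) *
      ((1 - B * cos (H * s)) / √(1 + B ^ 2 + 2 * B * -cos (H * s))) =
      B * sin (H * s) / √(1 + B ^ 2 + 2 * B * -cos (H * s)) :=
    div_mul_div_cancel₀ hc
  rw [hcancel]
  ring

/-- Both signs of `s` at once: `ρ'(s)` has the sign opposite to that of `s`. -/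
theorem mul_deriv_kenRho_neg {H B a b : ℝ} (hH : 0 < H) (hB0 : 0 < B) (hB1 : B < 1)
    (ha : 0 < a) (hab : a ^ 2 ≤ b ^ 2) {s : ℝ} (hs : s ≠ 0)
    (hlt : |s| < (1 / H) * arcsin (-B) + π / (2 * H)) :
    s * deriv (kenRho H B a b) s < 0 := by
  have hHs : |H * s| < arccos B := by
    rw [abs_mul, abs_of_pos hH, arccos]
    calc H * |s| < H * ((1 / H) * arcsin (-B) + π / (2 * H)) := mul_lt_mul_of_pos_left hlt hH
      _ = π / 2 - arcsin B := by
        rw [arcsin_neg]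
        field_simp
        ring
  have hπ : |H * s| < π := hHs.trans_le (arccos_le_pi B)
  have hcos : B < cos (H * s) := by
    rw [← cos_abs, ← cos_arccos (by linarith : -1 ≤ B) hB1.le]
    exact cos_lt_cos_of_nonneg_of_le_pi (abs_nonneg _) (arccos_le_pi B) hHs
  have hk : 1 ≤ b ^ 2 / a ^ 2 := (one_le_div (by positivity)).2 hab
  have hsin : 0 ≤ s * sin (H * s) := by
    rcases le_total 0 s with h | h
    · exact mul_nonneg h (sin_nonneg_of_nonneg_of_le_pi (by positivity) (abs_lt.1 hπ).2.le)
    · exact mul_nonneg_of_nonpos_of_nonpos h (sin_nonpos_of_nonpos_of_neg_pi_le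
        (mul_nonpos_of_nonneg_of_nonpos hH.le h) (abs_lt.1 hπ).1.le)
  have hz : 0 < s * kenZ H B s := by
    have hmono := strictMono_kenZ hH hB0 hB1
    rcases hs.lt_or_gt with h | h
    · exact mul_pos_of_neg_of_neg h (kenZ_zero H B ▸ hmono h)
    · exact mul_pos h (kenZ_zero H B ▸ hmono h)
  have hx : 0 ≤ B * (s * sin (H * s)) / √(1 + B ^ 2 + 2 * B * -cos (H * s)) := by positivity
  have hq : 0 < B * H * (cos (H * s) - B) / (1 - B * cos (H * s)) ^ 2 :=
    div_pos (mul_pos (mul_pos hB0 hH) (sub_pos.2 hcos))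
      (pow_pos (one_sub_mul_cos_pos hB0 hB1 _) 2)
  have hfirst := mul_nonneg (sub_nonneg.2 hk) hx
  have hsecond := mul_pos (one_pos.trans_le hk) (mul_pos hq hz)
  rw [(hasDerivAt_kenRho a b hH hB0 hB1 s).deriv]
  calc _ = -((b ^ 2 / a ^ 2 - 1) *
          (B * (s * sin (H * s)) / √(1 + B ^ 2 + 2 * B * -cos (H * s)))) -
        b ^ 2 / a ^ 2 *
          (B * H * (cos (H * s) - B) / (1 - B * cos (H * s)) ^ 2 * (s * kenZ H B s)) := by ring
    _ < 0 := by linarith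

/-- For the unduloid (`0 < B < 1`) with `a² ≤ b²`, `ρ` is strictly increasing on
`(-s₀, 0)` and strictly decreasing on `(0, s₀)`; in particular `ρ' > 0` on
`(-s₀, 0)` and `ρ' < 0` on `(0, s₀)`, where `s₀ = (1/H) arcsin(-B) + π/(2H)`. -/
theorem unduloid_rho_monotone (H B a b : ℝ) (hH : 0 < H) (hB0 : 0 < B)
    (hB1 : B < 1) (ha : 0 < a) (hb : 0 < b) (hab : a ^ 2 ≤ b ^ 2) :
    StrictMonoOn (kenRho H B a b)
      (Set.Ioo (-((1 / H) * Real.arcsin (-B) + Real.pi / (2 * H))) 0) ∧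
    StrictAntiOn (kenRho H B a b)
      (Set.Ioo 0 ((1 / H) * Real.arcsin (-B) + Real.pi / (2 * H))) ∧
    (∀ s ∈ Set.Ioo (-((1 / H) * Real.arcsin (-B) + Real.pi / (2 * H))) 0,
      0 < deriv (kenRho H B a b) s) ∧
    (∀ s ∈ Set.Ioo 0 ((1 / H) * Real.arcsin (-B) + Real.pi / (2 * H)),
      deriv (kenRho H B a b) s < 0) := by
  have hneg : ∀ s ∈ Set.Ioo (-((1 / H) * Real.arcsin (-B) + Real.pi / (2 * H))) 0,
      0 < deriv (kenRho H B a b) s := fun s hs =>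
    pos_of_mul_neg_right (mul_deriv_kenRho_neg hH hB0 hB1 ha hab hs.2.ne
      (abs_lt.2 ⟨hs.1, by linarith [hs.1, hs.2]⟩)) hs.2.le
  have hpos : ∀ s ∈ Set.Ioo 0 ((1 / H) * Real.arcsin (-B) + Real.pi / (2 * H)),
      deriv (kenRho H B a b) s < 0 := fun s hs =>
    neg_of_mul_neg_right (mul_deriv_kenRho_neg hH hB0 hB1 ha hab hs.1.ne'
      (abs_lt.2 ⟨by linarith [hs.1, hs.2], hs.2⟩)) hs.1.le
  have hcont : Continuous (kenRho H B a b) :=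
    continuous_iff_continuousAt.2 fun s => (hasDerivAt_kenRho a b hH hB0 hB1 s).continuousAt
  refine ⟨strictMonoOn_of_deriv_pos (convex_Ioo _ _) hcont.continuousOn ?_,
    strictAntiOn_of_deriv_neg (convex_Ioo _ _) hcont.continuousOn ?_, hneg, hpos⟩
  · rwa [interior_Ioo]
  · rwa [interior_Ioo]
end

section
/- Fix H > 0 and B > 1, let x(r) = (1/H)·√(1 + B² + 2B·sin(Hr + 3π/2)) and z(r) = ∫_{3π/(2H)}^{r + 3π/(2H)} (1 + B·sin(Ht))/√(1 + B² + 2B·sin(Ht)) dt, and set r₀ = (1/H)·arcsin(−1/B) + π/(2H). Then z'(r₀) = 0, r₀ is the smallest positive zero of z', and for all r ∈ (−r₀, r₀) one has z'(r) < 0 and x''(r) > 0. -/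
open Real

theorem sin_add_three_pi_div_two_s15 (θ : ℝ) : Real.sin (θ + 3 * Real.pi / 2) = -Real.cos θ := by
  rw [show θ + 3 * Real.pi / 2 = θ + Real.pi / 2 + Real.pi by ring, Real.sin_add_pi,
    Real.sin_add_pi_div_two]

/-- The radicand in Kenmotsu's formulas is positive as soon as `B > 1`. -/
theorem one_add_sq_add_two_mul_pos_s15 {B c : ℝ} (hB : 1 < B) (hc : -1 ≤ c) :
    0 < 1 + B ^ 2 + 2 * B * c := by
  nlinarith [mul_nonneg (by linarith : (0 : ℝ) ≤ B) (by linarith : 0 ≤ c + 1),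
    mul_pos (sub_pos.2 hB) (sub_pos.2 hB)]

theorem one_add_sq_sub_two_mul_cos_pos {B : ℝ} (hB : 1 < B) (θ : ℝ) :
    0 < 1 + B ^ 2 - 2 * B * Real.cos θ := by
  have := one_add_sq_add_two_mul_pos_s15 hB (neg_le_neg (Real.cos_le_one θ))
  linarith

theorem deriv_kenZ {H B : ℝ} (hH : 0 < H) (hB : 1 < B) (r : ℝ) :
    deriv (kenZ H B) r =
      (1 - B * Real.cos (H * r)) / Real.sqrt (1 + B ^ 2 - 2 * B * Real.cos (H * r)) := by
  have hcont : Continuous fun t : ℝ =>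
      (1 + B * Real.sin (H * t)) / Real.sqrt (1 + B ^ 2 + 2 * B * Real.sin (H * t)) := by
    refine Continuous.div (by fun_prop) (by fun_prop) fun t => ?_
    exact (Real.sqrt_pos.2 (one_add_sq_add_two_mul_pos_s15 hB (Real.neg_one_le_sin _))).ne'
  have hsin : Real.sin (H * (r + 3 * Real.pi / (2 * H))) = -Real.cos (H * r) := by
    rw [← sin_add_three_pi_div_two_s15]
    congr 1
    field_simp
  have hderiv := (hcont.integral_hasStrictDerivAt (3 * Real.pi / (2 * H))
    (r + 3 * Real.pi / (2 * H))).hasDerivAt.comp_add_const r (3 * Real.pi / (2 * H))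
  rw [hsin] at hderiv
  simp only [mul_neg, ← sub_eq_add_neg] at hderiv
  exact hderiv.deriv

theorem hasDerivAt_sqrt_one_add_sq_sub_two_mul_cos {B : ℝ} (H : ℝ) (hB : 1 < B) (r : ℝ) :
    HasDerivAt (fun s => Real.sqrt (1 + B ^ 2 - 2 * B * Real.cos (H * s)))
      (H * (B * Real.sin (H * r)) / Real.sqrt (1 + B ^ 2 - 2 * B * Real.cos (H * r))) r := by
  have hlin : HasDerivAt (fun s : ℝ => H * s) H r := by
    simpa using (hasDerivAt_id r).const_mul H
  have h := ((hlin.cos.const_mul (2 * B)).const_sub (1 + B ^ 2)).sqrt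
    (one_add_sq_sub_two_mul_cos_pos hB (H * r)).ne'
  convert h using 1
  have := (Real.sqrt_pos.2 (one_add_sq_sub_two_mul_cos_pos hB (H * r))).ne'
  field_simp

theorem deriv_kenX {H B : ℝ} (hH : 0 < H) (hB : 1 < B) :
    deriv (kenX H B) = fun r =>
      B * Real.sin (H * r) / Real.sqrt (1 + B ^ 2 - 2 * B * Real.cos (H * r)) := by
  have hX : kenX H B = fun s => 1 / H * Real.sqrt (1 + B ^ 2 - 2 * B * Real.cos (H * s)) := by
    funext s
    rw [kenX, sin_add_three_pi_div_two_s15, mul_neg, ← sub_eq_add_neg]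
  funext r
  rw [hX, ((hasDerivAt_sqrt_one_add_sq_sub_two_mul_cos H hB r).const_mul (1 / H)).deriv]
  field_simp

theorem deriv_deriv_kenX {H B : ℝ} (hH : 0 < H) (hB : 1 < B) (r : ℝ) :
    deriv (deriv (kenX H B)) r =
      H * B * ((B * Real.cos (H * r) - 1) * (B - Real.cos (H * r))) /
        Real.sqrt (1 + B ^ 2 - 2 * B * Real.cos (H * r)) ^ 3 := by
  have hq := one_add_sq_sub_two_mul_cos_pos hB (H * r)
  have hne := (Real.sqrt_pos.2 hq).ne'
  have hlin : HasDerivAt (fun s : ℝ => H * s) H r := by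
    simpa using (hasDerivAt_id r).const_mul H
  rw [deriv_kenX hH hB]
  refine ((hlin.sin.const_mul B).fun_div
    (hasDerivAt_sqrt_one_add_sq_sub_two_mul_cos H hB r) hne).deriv.trans ?_
  have hsq := Real.sq_sqrt hq.le
  have hsc := Real.sin_sq_add_cos_sq (H * r)
  generalize Real.sqrt (1 + B ^ 2 - 2 * B * Real.cos (H * r)) = w at *
  field_simp
  rw [hsq]
  linear_combination (-B) * hsc

/-- The first positive zero of `z'` is `arccos (1 / B) / H`. -/
theorem arcsin_neg_add_pi_div_two_mul (H B : ℝ) :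
    1 / H * Real.arcsin (-(1 / B)) + Real.pi / (2 * H) = Real.arccos (1 / B) / H := by
  rw [Real.arcsin_neg, Real.arccos]
  ring

/-- `cos` exceeds `a` on the interval `(-arccos a, arccos a)`. -/
theorem lt_cos_of_abs_lt_arccos {a θ : ℝ} (ha : -1 ≤ a) (ha' : a ≤ 1)
    (hθ : |θ| < Real.arccos a) : a < Real.cos θ := by
  rw [← Real.cos_abs θ, ← Real.cos_arccos ha ha']
  exact Real.cos_lt_cos_of_nonneg_of_le_pi (abs_nonneg θ) (Real.arccos_le_pi a) hθ

/-- For the nodoid (`B > 1`): `r₀ = (1/H) arcsin(-1/B) + π/(2H)` is the smallest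
positive zero of `z'`, and `z' < 0`, `x'' > 0` on `(-r₀, r₀)`. -/
theorem nodoid_basic_properties (H B : ℝ) (hH : 0 < H) (hB : 1 < B) :
    deriv (kenZ H B) ((1 / H) * Real.arcsin (-(1 / B)) + Real.pi / (2 * H)) = 0 ∧
    0 < (1 / H) * Real.arcsin (-(1 / B)) + Real.pi / (2 * H) ∧
    (∀ r : ℝ, 0 < r → deriv (kenZ H B) r = 0 →
      (1 / H) * Real.arcsin (-(1 / B)) + Real.pi / (2 * H) ≤ r) ∧
    (∀ r ∈ Set.Ioo (-((1 / H) * Real.arcsin (-(1 / B)) + Real.pi / (2 * H)))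
        ((1 / H) * Real.arcsin (-(1 / B)) + Real.pi / (2 * H)),
      deriv (kenZ H B) r < 0 ∧ 0 < deriv (deriv (kenX H B)) r) := by
  have hB0 : 0 < B := by linarith
  have hinv0 : 0 < 1 / B := by positivity
  have hinv1 : 1 / B < 1 := (div_lt_one hB0).2 hB
  have hcos : ∀ r, |r| < Real.arccos (1 / B) / H → 1 < B * Real.cos (H * r) := by
    intro r hr
    rw [lt_div_iff₀ hH] at hr
    have h := lt_cos_of_abs_lt_arccos (θ := H * r) (by linarith) hinv1.le
      (by rwa [abs_mul, abs_of_pos hH, mul_comm])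
    rwa [div_lt_iff₀' hB0] at h
  have hz : ∀ r, |r| < Real.arccos (1 / B) / H → deriv (kenZ H B) r < 0 := by
    intro r hr
    rw [deriv_kenZ hH hB]
    exact div_neg_of_neg_of_pos (by linarith [hcos r hr])
      (Real.sqrt_pos.2 (one_add_sq_sub_two_mul_cos_pos hB _))
  rw [arcsin_neg_add_pi_div_two_mul]
  refine ⟨?_, div_pos (Real.arccos_pos.2 hinv1) hH, fun r hr hr0 => ?_,
    fun r hr => ⟨hz r (abs_lt.2 hr), ?_⟩⟩
  · rw [deriv_kenZ hH hB, mul_div_cancel₀ _ hH.ne', Real.cos_arccos (by linarith) hinv1.le,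
      mul_one_div_cancel hB0.ne', sub_self, zero_div]
  · by_contra! hlt
    exact (hz r (by rwa [abs_of_pos hr])).ne hr0
  · rw [deriv_deriv_kenX hH hB]
    have hc := hcos r (abs_lt.2 hr)
    have hc1 := Real.cos_le_one (H * r)
    have hw := Real.sqrt_pos.2 (one_add_sq_sub_two_mul_cos_pos hB (H * r))
    exact div_pos (mul_pos (mul_pos hH hB0) (mul_pos (by linarith) (by linarith))) (pow_pos hw 3)
end
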